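/- arXiv:2108.12754 — 3 statements merged into one kernel-verified Lean document; each statement's English description precedes it below -/
import Mathlib

section
/- Let G be a block graph and let u, v be vertices of G. Then d(u,v) = L(u) + L(v) + δ(u,v) − 2φ(u,v) − ρ(u,v). -/
open scoped Classical

namespace RadioLabeling

variable {V : Type*} [Fintype V]

/-- The diameter of a graph: maximum distance between two vertices. -/
noncomputable def diam (G : SimpleGraph V) : ℕ :=
  Finset.univ.sup fun p : V × V => G.dist p.1 p.2

/-- A vertex set `S` induces a 2-connected subgraph: the induced subgraph is connected
and contains no cut-vertex. -/
def TwoConn (G : SimpleGraph V) (S : Set V) : Prop :=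
  (G.induce S).Connected ∧ ∀ v ∈ S, (S \ {v} : Set V) = ∅ ∨ (G.induce (S \ {v})).Connected

/-- A block: a maximal 2-connected induced subgraph. -/
def IsBlock (G : SimpleGraph V) (S : Set V) : Prop :=
  TwoConn G S ∧ ∀ T : Set V, S ⊆ T → TwoConn G T → T = S

/-- A block graph: a connected graph each of whose blocks is a clique. -/
def IsBlockGraph (G : SimpleGraph V) : Prop :=
  G.Connected ∧ ∀ S : Set V, IsBlock G S → G.IsClique S

/-- The weight of `G` at `v`: the sum of distances from `v` to all vertices. -/
noncomputable def wt (G : SimpleGraph V) (v : V) : ℕ := ∑ u : V, G.dist u v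

/-- The set of weight centers: vertices minimizing the weight. -/
def weightCenters (G : SimpleGraph V) : Set V := {v | ∀ u : V, wt G v ≤ wt G u}

/-- `nCloser G v u` = number of vertices strictly closer to `v` than to `u`. -/
noncomputable def nCloser (G : SimpleGraph V) (v u : V) : ℕ :=
  (Finset.univ.filter fun z => G.dist v z < G.dist u z).card

/-- A central vertex: either the unique weight center, or (when there are at least two
weight centers) a vertex of the central block, i.e. of a block containing all weight centers. -/
def IsCentral (G : SimpleGraph V) (w : V) : Prop :=
  weightCenters G = {w} ∨
    (2 ≤ (weightCenters G).ncard ∧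
      ∃ S : Set V, IsBlock G S ∧ weightCenters G ⊆ S ∧ w ∈ S)

/-- The level of a vertex: its distance to a nearest central vertex. -/
noncomputable def level (G : SimpleGraph V) (v : V) : ℕ :=
  sInf {n | ∃ w, IsCentral G w ∧ G.dist v w = n}

/-- The total level of `G`. -/
noncomputable def totalLevel (G : SimpleGraph V) : ℕ := ∑ v : V, level G v

/-- `eps G = 1` if `G` has a unique weight center, `0` otherwise. -/
noncomputable def eps (G : SimpleGraph V) : ℕ :=
  if (weightCenters G).ncard = 1 then 1 else 0

/-- A radio labeling: `|f u - f v| ≥ diam G + 1 - dist u v` for all distinct `u`, `v`. -/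
def IsRadioLabeling (G : SimpleGraph V) (f : V → ℕ) : Prop :=
  ∀ u v : V, u ≠ v → diam G + 1 ≤ G.dist u v + max (f u - f v) (f v - f u)

/-- The span of a labeling: the maximum difference of two labels. -/
noncomputable def span (f : V → ℕ) : ℕ :=
  Finset.univ.sup fun p : V × V => f p.1 - f p.2

/-- The radio number: minimum span of a radio labeling. -/
noncomputable def rn (G : SimpleGraph V) : ℕ :=
  sInf {s | ∃ f : V → ℕ, IsRadioLabeling G f ∧ span f = s}

/-- `G` achieves the lower bound `(p-1)(d(G)+ε(G)) - 2L(G) + ε(G)` for the radio number. -/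
def lbEq (G : SimpleGraph V) : Prop :=
  (rn G : ℤ) =
    ((Fintype.card V : ℤ) - 1) * ((diam G : ℤ) + (eps G : ℤ)) -
      2 * (totalLevel G : ℤ) + (eps G : ℤ)

/-- A lower bound block graph: a block graph whose radio number equals the lower bound. -/
def IsLowerBoundBlockGraph (G : SimpleGraph V) : Prop := IsBlockGraph G ∧ lbEq G

/-- `x` lies on a `(u,v)`-geodesic. -/
def OnGeodesic (G : SimpleGraph V) (x u v : V) : Prop :=
  G.dist u v = G.dist u x + G.dist x v

/-- `x` is an ancestor of `v` (and `v` a descendent of `x`): `x` lies on the geodesic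
from some central vertex to `v`. -/
def IsAncestor (G : SimpleGraph V) (x v : V) : Prop :=
  ∃ w : V, IsCentral G w ∧ OnGeodesic G x w v

/-- `phi G u v`: the maximum level of a common ancestor of `u` and `v`. -/
noncomputable def phi (G : SimpleGraph V) (u v : V) : ℕ :=
  sSup {n | ∃ x, IsAncestor G x u ∧ IsAncestor G x v ∧ level G x = n}

/-- `delta G u v = 1` iff the `(u,v)`-geodesic contains two central vertices. -/
noncomputable def delta (G : SimpleGraph V) (u v : V) : ℕ :=
  if ∃ x y : V, x ≠ y ∧ IsCentral G x ∧ IsCentral G y ∧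
      OnGeodesic G x u v ∧ OnGeodesic G y u v
    then 1 else 0

/-- `rho G u v = 0` iff the `(u,v)`-geodesic contains a central vertex or a common
ancestor of `u` and `v`. -/
noncomputable def rho (G : SimpleGraph V) (u v : V) : ℕ :=
  if ∃ x : V, OnGeodesic G x u v ∧
      (IsCentral G x ∨ (IsAncestor G x u ∧ IsAncestor G x v))
    then 0 else 1

/-- The central block: a block containing at least two weight centers, all of them. -/
def IsCentralBlock (G : SimpleGraph V) (D : Set V) : Prop :=
  IsBlock G D ∧ 2 ≤ (weightCenters G).ncard ∧ weightCenters G ⊆ D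

/-- `v` belongs to the branch of `G` determined by the non-central block `D` adjacent to the
central vertex `w`: `v` is a vertex of `D` other than `w`, or a descendent of such a vertex. -/
def InBranch (G : SimpleGraph V) (w : V) (D : Set V) (v : V) : Prop :=
  IsCentral G w ∧ IsBlock G D ∧ w ∈ D ∧ ¬ IsCentralBlock G D ∧
    ∃ u ∈ D, u ≠ w ∧ IsAncestor G u v

/-- Two vertices are in different branches: branches induced by two different blocks
adjacent to the same central vertex. -/
def DifferentBranches (G : SimpleGraph V) (u v : V) : Prop :=
  ∃ w D₁ D₂, D₁ ≠ D₂ ∧ InBranch G w D₁ u ∧ InBranch G w D₂ v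

/-- Two vertices are in opposite branches: branches induced by blocks adjacent to two
different central vertices. -/
def OppositeBranches (G : SimpleGraph V) (u v : V) : Prop :=
  ∃ w₁ w₂ D₁ D₂, w₁ ≠ w₂ ∧ InBranch G w₁ D₁ u ∧ InBranch G w₂ D₂ v

/-- Two vertices lie in the same branch. -/
def SameBranch (G : SimpleGraph V) (u v : V) : Prop :=
  ∃ w D, InBranch G w D u ∧ InBranch G w D v

section BlockGraph

variable {G : SimpleGraph V}

omit [Fintype V] in
lemma connected_induce_of_walks {S : Set V} {b : V} (hb : b ∈ S)
    (h : ∀ z ∈ S, ∃ p : G.Walk b z, ∀ t ∈ p.support, t ∈ S) : (G.induce S).Connected := by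
  refine SimpleGraph.induce_connected_of_patches b hb fun {z} hz => ?_
  obtain ⟨p, hp⟩ := h z hz
  exact ⟨{t | t ∈ p.support}, hp, p.start_mem_support, p.end_mem_support,
    p.connected_induce_support _ _⟩

omit [Fintype V] in
lemma connected_induce_of_isClique {S : Set V} (hS : G.IsClique S) (hne : S.Nonempty) :
    (G.induce S).Connected := by
  obtain ⟨b, hb⟩ := hne
  refine connected_induce_of_walks hb fun z hz => ?_
  by_cases hbz : b = z
  · subst hbz
    exact ⟨.nil, by simpa using hb⟩
  · exact ⟨.cons (hS hb hz hbz) .nil, by simp [hb, hz]⟩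

omit [Fintype V] in
lemma twoConn_of_isClique {S : Set V} (hS : G.IsClique S) (hne : S.Nonempty) : TwoConn G S := by
  refine ⟨connected_induce_of_isClique hS hne, fun v _ => ?_⟩
  rcases (S \ {v}).eq_empty_or_nonempty with h | h
  · exact .inl h
  · exact .inr (connected_induce_of_isClique (hS.subset Set.sdiff_subset) h)

lemma exists_isBlock_superset {S : Set V} (hS : TwoConn G S) : ∃ T, IsBlock G T ∧ S ⊆ T := by
  obtain ⟨T, hST, hT⟩ := (Set.toFinite {T : Set V | TwoConn G T}).exists_le_maximal hS
  exact ⟨T, ⟨hT.prop, fun U hTU hU => (hT.eq_of_le hU hTU).symm⟩, hST⟩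

lemma IsBlockGraph.isClique_of_twoConn (hG : IsBlockGraph G) {S : Set V} (hS : TwoConn G S) :
    G.IsClique S := by
  obtain ⟨T, hT, hST⟩ := exists_isBlock_superset hS
  exact (hG.2 T hT).subset hST

omit [Fintype V] in
lemma exists_walk_avoiding {x y : V} {p : G.Walk x y} (hp : p.IsPath) {q z : V}
    (hz : z ∈ p.support) (hqz : z ≠ q) :
    (∃ r : G.Walk x z, q ∉ r.support ∧ ∀ t ∈ r.support, t ∈ p.support) ∨
      ∃ r : G.Walk y z, q ∉ r.support ∧ ∀ t ∈ r.support, t ∈ p.support := by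
  by_cases h₁ : q ∈ (p.takeUntil z hz).support
  · right
    refine ⟨(p.dropUntil z hz).reverse, fun h₂ => ?_, fun t ht => ?_⟩
    · rw [SimpleGraph.Walk.support_reverse, List.mem_reverse] at h₂
      have hnd := hp.support_nodup
      rw [← p.take_spec hz, SimpleGraph.Walk.support_append] at hnd
      rw [← SimpleGraph.Walk.cons_tail_support, List.mem_cons] at h₂
      exact (List.nodup_append'.1 hnd).2.2 h₁ (h₂.resolve_left hqz.symm)
    · rw [SimpleGraph.Walk.support_reverse, List.mem_reverse] at ht
      exact p.support_dropUntil_subset_support hz ht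
  · exact .inl ⟨_, h₁, fun t ht => p.support_takeUntil_subset_support hz ht⟩

omit [Fintype V] in
/-- The vertices of a cycle through `b` induce a 2-connected subgraph. -/
lemma twoConn_insert_support {b x y : V} (hx : G.Adj b x) (hy : G.Adj b y) {p : G.Walk x y}
    (hp : p.IsPath) (hb : b ∉ p.support) : TwoConn G (insert b {t | t ∈ p.support}) := by
  have key : ∀ q, q ≠ b → ∀ z ∈ p.support, z ≠ q → ∃ r : G.Walk b z,
      ∀ t ∈ r.support, t ∈ insert b {t | t ∈ p.support} \ {q} := by
    intro q hqb z hz hzq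
    rcases exists_walk_avoiding hp hz hzq with ⟨r, hq, hr⟩ | ⟨r, hq, hr⟩
    · refine ⟨.cons hx r, fun t ht => ?_⟩
      rw [SimpleGraph.Walk.support_cons, List.mem_cons] at ht
      rcases ht with rfl | ht
      · exact ⟨.inl rfl, hqb.symm⟩
      · exact ⟨.inr (hr t ht), fun h => hq (h ▸ ht)⟩
    · refine ⟨.cons hy r, fun t ht => ?_⟩
      rw [SimpleGraph.Walk.support_cons, List.mem_cons] at ht
      rcases ht with rfl | ht
      · exact ⟨.inl rfl, hqb.symm⟩
      · exact ⟨.inr (hr t ht), fun h => hq (h ▸ ht)⟩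
  refine ⟨?_, fun q _ => .inr ?_⟩
  · refine connected_induce_of_walks (.inl rfl) fun z hz => ?_
    rcases hz with rfl | hz
    · exact ⟨.nil, by simp⟩
    · refine ⟨.cons hx (p.takeUntil z hz), fun t ht => ?_⟩
      rw [SimpleGraph.Walk.support_cons, List.mem_cons] at ht
      exact ht.imp id fun h => p.support_takeUntil_subset_support hz h
  · by_cases hqb : q = b
    · subst hqb
      rw [Set.insert_sdiff_self_of_notMem (by simpa using hb)]
      exact p.connected_induce_support
    · refine connected_induce_of_walks ⟨.inl rfl, fun h => hqb h.symm⟩ ?_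
      rintro z ⟨rfl | hz, hzq⟩
      · exact ⟨.nil, by simpa using fun h => hqb h.symm⟩
      · exact key q hqb z hz hzq

lemma IsBlockGraph.adj_of_walk_avoiding (hG : IsBlockGraph G) {b x y : V} (hx : G.Adj b x)
    (hy : G.Adj b y) (hxy : x ≠ y) (p : G.Walk x y) (hb : b ∉ p.support) : G.Adj x y :=
  hG.isClique_of_twoConn
    (twoConn_insert_support hx hy p.bypass_isPath fun h => hb (p.support_bypass_subset_support h))
    (.inr (SimpleGraph.Walk.start_mem_support _)) (.inr (SimpleGraph.Walk.end_mem_support _)) hxy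

omit [Fintype V] in
lemma onGeodesic_of_mem_support (hG : G.Connected) {a b c : V} {p : G.Walk a c}
    (hp : p.length = G.dist a c) (hb : b ∈ p.support) : OnGeodesic G b a c := by
  have h := congrArg SimpleGraph.Walk.length (p.take_spec hb)
  rw [SimpleGraph.Walk.length_append] at h
  have h₁ := SimpleGraph.dist_le (p.takeUntil b hb)
  have h₂ := SimpleGraph.dist_le (p.dropUntil b hb)
  have h₃ := hG.dist_triangle (u := a) (v := b) (w := c)
  unfold OnGeodesic
  omega

omit [Fintype V] in
lemma exists_walk_avoiding_of_not_onGeodesic (hG : G.Connected) {a b c : V}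
    (h : ¬ OnGeodesic G b a c) : ∃ p : G.Walk a c, b ∉ p.support := by
  obtain ⟨p, hp⟩ := hG.exists_walk_length_eq_dist a c
  exact ⟨p, fun hb => h (onGeodesic_of_mem_support hG hp hb)⟩

omit [Fintype V] in
lemma exists_adj_dist_add_one (hG : G.Connected) {a b : V} (hab : b ≠ a) :
    ∃ x, G.Adj b x ∧ G.dist x a + 1 = G.dist b a := by
  obtain ⟨p, hp⟩ := hG.exists_walk_length_eq_dist b a
  cases p with
  | nil => exact absurd rfl hab
  | @cons _ x _ h p =>
    refine ⟨x, h, ?_⟩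
    have h₁ := SimpleGraph.dist_le p
    have h₂ := hG.dist_triangle (u := b) (v := x) (w := a)
    rw [SimpleGraph.dist_eq_one_iff_adj.2 h] at h₂
    rw [SimpleGraph.Walk.length_cons] at hp
    omega

/-- In a block graph, a vertex on a geodesic separates its ends. -/
lemma IsBlockGraph.onGeodesic_or (hG : IsBlockGraph G) {a b c : V} (hb : OnGeodesic G b a c)
    (z : V) : OnGeodesic G b a z ∨ OnGeodesic G b c z := by
  by_contra! h
  have hba : b ≠ a := by rintro rfl; simp [OnGeodesic] at h
  have hbc : b ≠ c := by rintro rfl; simp [OnGeodesic] at h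
  obtain ⟨x, hx, hxa⟩ := exists_adj_dist_add_one hG.1 hba
  obtain ⟨y, hy, hyc⟩ := exists_adj_dist_add_one hG.1 hbc
  have hxac := hG.1.dist_triangle (u := a) (v := x) (w := c)
  have hxyc := hG.1.dist_triangle (u := x) (v := y) (w := c)
  rw [OnGeodesic, SimpleGraph.dist_comm (u := a) (v := b)] at hb
  rw [SimpleGraph.dist_comm (u := a) (v := x)] at hxac
  have hxy : x ≠ y := by
    rintro rfl
    omega
  obtain ⟨p₁, hp₁⟩ := exists_walk_avoiding_of_not_onGeodesic hG.1 (a := x) (b := b) (c := a)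
    (by unfold OnGeodesic; omega)
  obtain ⟨p₂, hp₂⟩ := exists_walk_avoiding_of_not_onGeodesic hG.1 h.1
  obtain ⟨p₃, hp₃⟩ := exists_walk_avoiding_of_not_onGeodesic hG.1 h.2
  obtain ⟨p₄, hp₄⟩ := exists_walk_avoiding_of_not_onGeodesic hG.1 (a := y) (b := b) (c := c)
    (by unfold OnGeodesic; omega)
  have hadj := hG.adj_of_walk_avoiding hx hy hxy
    (p₁.append (p₂.append (p₃.reverse.append p₄.reverse)))
    (by simp [SimpleGraph.Walk.mem_support_append_iff, hp₁, hp₂, hp₃, hp₄])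
  have := SimpleGraph.dist_eq_one_iff_adj.2 hadj
  omega

/-- The weight of a block graph is strictly convex along geodesics. -/
lemma IsBlockGraph.wt_lt_of_onGeodesic (hG : IsBlockGraph G) {a b c : V}
    (hb : OnGeodesic G b a c) (hba : b ≠ a) (hbc : b ≠ c) :
    (G.dist a b + G.dist b c) * wt G b < G.dist b c * wt G a + G.dist a b * wt G c := by
  have hs := hG.1.pos_dist_of_ne hba.symm
  have ht := hG.1.pos_dist_of_ne hbc
  unfold wt
  simp only [Finset.mul_sum, ← Finset.sum_add_distrib]
  refine Finset.sum_lt_sum (fun z _ => ?_) ⟨b, Finset.mem_univ _, ?_⟩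
  · have h₁ := hG.1.dist_triangle (u := z) (v := a) (w := b)
    have h₂ := hG.1.dist_triangle (u := z) (v := c) (w := b)
    rw [SimpleGraph.dist_comm (u := c) (v := b)] at h₂
    rcases hG.onGeodesic_or hb z with h | h
    · rw [OnGeodesic, SimpleGraph.dist_comm (u := a) (v := z),
        SimpleGraph.dist_comm (u := b) (v := z)] at h
      nlinarith
    · rw [OnGeodesic, SimpleGraph.dist_comm (u := c) (v := z),
        SimpleGraph.dist_comm (u := b) (v := z), SimpleGraph.dist_comm (u := c) (v := b)] at h
      nlinarith
  · rw [SimpleGraph.dist_self, SimpleGraph.dist_comm (u := b) (v := a)]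
    have := Nat.mul_pos ht hs
    omega

lemma IsBlockGraph.isClique_weightCenters (hG : IsBlockGraph G) :
    G.IsClique (weightCenters G) := by
  intro a ha c hc hac
  obtain ⟨b, hab, hbc⟩ := exists_adj_dist_add_one hG.1 hac
  have hab' := SimpleGraph.dist_eq_one_iff_adj.2 hab
  by_cases h : b = c
  · exact h ▸ hab
  have := hG.wt_lt_of_onGeodesic (a := a) (b := b) (c := c) (by unfold OnGeodesic; omega)
    hab.ne' h
  have h₁ := Nat.mul_le_mul_left (G.dist b c) (ha b)
  have h₂ := Nat.mul_le_mul_left (G.dist a b) (hc b)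
  rw [add_mul] at this
  omega

omit [Fintype V] in
lemma IsBlockGraph.isBlock_unique (hG : IsBlockGraph G) {S T : Set V} (hS : IsBlock G S)
    (hT : IsBlock G T) {a b : V} (hab : a ≠ b) (haS : a ∈ S) (hbS : b ∈ S) (haT : a ∈ T)
    (hbT : b ∈ T) : S = T := by
  have hSc := hG.2 S hS
  have hTc := hG.2 T hT
  have hST : TwoConn G (S ∪ T) := by
    refine ⟨SimpleGraph.induce_union_connected hS.1.1.preconnected hT.1.1.preconnected
      ⟨a, haS, haT⟩,
      fun q _ => .inr ?_⟩
    obtain ⟨c, hcS, hcT, hcq⟩ : ∃ c, c ∈ S ∧ c ∈ T ∧ c ≠ q := by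
      by_cases h : a = q
      · exact ⟨b, hbS, hbT, fun hb => hab (h.trans hb.symm)⟩
      · exact ⟨a, haS, haT, h⟩
    rw [Set.union_sdiff_distrib]
    exact SimpleGraph.induce_union_connected
      (connected_induce_of_isClique (hSc.subset Set.sdiff_subset) ⟨c, hcS, hcq⟩).preconnected
      (connected_induce_of_isClique (hTc.subset Set.sdiff_subset) ⟨c, hcT, hcq⟩).preconnected
      ⟨c, ⟨hcS, hcq⟩, hcT, hcq⟩
  exact (hS.2 _ Set.subset_union_left hST).symm.trans (hT.2 _ Set.subset_union_right hST)

lemma IsBlockGraph.isCentral_cases (hG : IsBlockGraph G) :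
    (∃ w, ∀ x, IsCentral G x ↔ x = w) ∨ ∃ S, IsBlock G S ∧ ∀ x, IsCentral G x ↔ x ∈ S := by
  have hne : (weightCenters G).Nonempty := by
    have := hG.1.nonempty
    obtain ⟨w, hw⟩ := Finite.exists_min (wt G)
    exact ⟨w, hw⟩
  by_cases h2 : 2 ≤ (weightCenters G).ncard
  · right
    obtain ⟨S, hS, hWS⟩ :=
      exists_isBlock_superset (twoConn_of_isClique hG.isClique_weightCenters hne)
    refine ⟨S, hS, fun x => ⟨?_, fun hx => .inr ⟨h2, S, hS, hWS, hx⟩⟩⟩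
    rintro (h | ⟨-, T, hT, hWT, hx⟩)
    · simp [h] at h2
    · obtain ⟨a, ha, b, hb, hab⟩ := (Set.one_lt_ncard).1 h2
      rwa [hG.isBlock_unique hS hT hab (hWS ha) (hWS hb) (hWT ha) (hWT hb)]
  · left
    have h1 : (weightCenters G).ncard = 1 := by
      have := (Set.ncard_pos (Set.toFinite _)).2 hne
      omega
    obtain ⟨w, hw⟩ := Set.ncard_eq_one.1 h1
    refine ⟨w, fun x => ⟨?_, ?_⟩⟩
    · rintro (h | ⟨h, -⟩)
      · exact (Set.singleton_injective (hw.symm.trans h)).symm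
      · exact absurd h h2
    · rintro rfl
      exact .inl hw

/-- Every block of a block graph has, for each vertex `v`, a unique vertex nearest to `v`. -/
lemma IsBlockGraph.exists_gate_of_isBlock (hG : IsBlockGraph G) {S : Set V} (hS : IsBlock G S)
    (v : V) : ∃ g ∈ S, ∀ w ∈ S, w ≠ g → G.dist w v = G.dist g v + 1 := by
  have hne : S.Nonempty := Set.nonempty_coe_sort.1 hS.1.1.nonempty
  have hc := hG.2 S hS
  obtain ⟨g, hg, hmin⟩ := S.exists_min_image (fun w => G.dist w v) (Set.toFinite _) hne
  refine ⟨g, hg, fun w hw hwg => ?_⟩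
  have hwg1 := SimpleGraph.dist_eq_one_iff_adj.2 (hc hw hg hwg)
  have htri := hG.1.dist_triangle (u := w) (v := g) (w := v)
  have hle := hmin w hw
  by_contra hd
  have heq : G.dist w v = G.dist g v := by omega
  have hgv : g ≠ v := by
    rintro rfl
    rw [SimpleGraph.dist_self] at heq
    omega
  obtain ⟨x, hgx, hxv⟩ := exists_adj_dist_add_one hG.1 hgv
  have hxS : x ∉ S := fun h => by
    have := hmin x h
    omega
  obtain ⟨p₁, hp₁⟩ := exists_walk_avoiding_of_not_onGeodesic hG.1 (a := x) (b := g) (c := v)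
    (by unfold OnGeodesic; omega)
  obtain ⟨p₂, hp₂⟩ := exists_walk_avoiding_of_not_onGeodesic hG.1 (a := w) (b := g) (c := v)
    (by unfold OnGeodesic; omega)
  have hxw : G.Adj x w := hG.adj_of_walk_avoiding hgx (hc hg hw hwg.symm)
    (fun h => hxS (h ▸ hw)) (p₁.append p₂.reverse)
    (by simp [SimpleGraph.Walk.mem_support_append_iff, hp₁, hp₂])
  have hclique : G.IsClique (insert x S) := by
    refine hc.insert fun z hz hxz => ?_
    by_cases hzg : z = g
    · exact hzg ▸ hgx.symm
    by_cases hzw : z = w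
    · exact hzw ▸ hxw
    exact hG.adj_of_walk_avoiding hgx (hc hg hz (Ne.symm hzg)) hxz
      (.cons hxw (.cons (hc hw hz (Ne.symm hzw)) .nil))
      (by simp [hgx.ne, hwg.symm, Ne.symm hzg])
  have := hS.2 _ (Set.subset_insert x S) (twoConn_of_isClique hclique ⟨x, .inl rfl⟩)
  exact hxS (this ▸ Set.mem_insert x S)

/-- The central vertex `g` is the nearest one to `v`, and is passed on the way from every other
central vertex to `v`. -/
def IsGate (G : SimpleGraph V) (g v : V) : Prop :=
  IsCentral G g ∧ ∀ w, IsCentral G w → w ≠ g → G.dist w v = G.dist g v + 1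

/-- The central vertex nearest to a vertex, in a block graph. -/
lemma IsBlockGraph.exists_gate (hG : IsBlockGraph G) (v : V) :
    ∃ g, IsGate G g v := by
  rcases hG.isCentral_cases with ⟨w, hw⟩ | ⟨S, hS, hw⟩
  · exact ⟨w, (hw w).2 rfl, fun x hx hxw => absurd ((hw x).1 hx) hxw⟩
  · simpa only [IsGate, hw] using hG.exists_gate_of_isBlock hS v

lemma IsGate.level_eq {g v : V} (h : IsGate G g v) : level G v = G.dist g v := by
  refine le_antisymm (Nat.sInf_le ⟨g, h.1, SimpleGraph.dist_comm⟩)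
    (le_csInf ⟨_, g, h.1, rfl⟩ ?_)
  rintro _ ⟨w, hw, rfl⟩
  by_cases hwg : w = g
  · rw [hwg, SimpleGraph.dist_comm]
  · rw [SimpleGraph.dist_comm (u := v), h.2 w hw hwg]
    omega

lemma level_le_dist {w v : V} (hw : IsCentral G w) : level G v ≤ G.dist v w :=
  Nat.sInf_le ⟨w, hw, rfl⟩

lemma level_eq_zero {w : V} (hw : IsCentral G w) : level G w = 0 := by
  simpa using level_le_dist (v := w) hw

lemma IsBlockGraph.dist_eq_one_of_isCentral (hG : IsBlockGraph G) {w g : V} (hw : IsCentral G w)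
    (hg : IsCentral G g) (hwg : w ≠ g) : G.dist w g = 1 := by
  obtain ⟨k, hk, hgate⟩ := hG.exists_gate g
  by_cases hgk : g = k
  · subst hgk
    simpa using hgate w hw hwg
  · have := hgate g hg hgk
    simp at this

lemma IsGate.of_onGeodesic (hG : IsBlockGraph G) {g x v : V} (h : IsGate G g v)
    (hx : OnGeodesic G x g v) : IsGate G g x := by
  refine ⟨h.1, fun w hw hwg => ?_⟩
  have h₁ := h.2 w hw hwg
  have h₂ := hG.1.dist_triangle (u := w) (v := x) (w := v)
  have h₃ := hG.1.dist_triangle (u := w) (v := g) (w := x)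
  have h₄ := hG.dist_eq_one_of_isCentral hw h.1 hwg
  unfold OnGeodesic at hx
  omega

lemma IsGate.onGeodesic_of_isAncestor (hG : IsBlockGraph G) {g x v : V} (h : IsGate G g v)
    (hx : IsAncestor G x v) : IsCentral G x ∨ OnGeodesic G x g v := by
  obtain ⟨w, hw, hwx⟩ := hx
  by_cases hwg : w = g
  · exact .inr (hwg ▸ hwx)
  have h₁ := h.2 w hw hwg
  have h₂ := hG.dist_eq_one_of_isCentral hw h.1 hwg
  have hc := SimpleGraph.dist_comm (G := G) (u := v) (v := g)
  have hc' := SimpleGraph.dist_comm (G := G) (u := v) (v := x)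
  unfold OnGeodesic at hwx ⊢
  rcases hG.onGeodesic_or (a := w) (b := g) (c := v) (by unfold OnGeodesic; omega) x with h₃ | h₃
  all_goals unfold OnGeodesic at h₃
  · right
    omega
  · left
    rcases Nat.eq_zero_or_pos (G.dist w x) with h₄ | h₄
    · exact hG.1.dist_eq_zero_iff.1 h₄ ▸ hw
    · exact (hG.1.dist_eq_zero_iff (u := g) (v := x)).1 (by omega) ▸ h.1

lemma isAncestor_of_isCentral {x : V} (hx : IsCentral G x)
    (v : V) : IsAncestor G x v := ⟨x, hx, by simp [OnGeodesic]⟩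

/-- Past the last common vertex `x` of the geodesics from `g` to `u` and to `v`, these geodesics
diverge, up to one edge. -/
lemma IsBlockGraph.dist_add_dist_le (hG : IsBlockGraph G) {g u v x : V}
    (hu : OnGeodesic G x g u) (hv : OnGeodesic G x g v)
    (hmax : ∀ y, OnGeodesic G y g u → OnGeodesic G y g v → G.dist g y ≤ G.dist g x) :
    G.dist u x + G.dist x v ≤ G.dist u v + 1 := by
  by_cases hxu : x = u
  · subst hxu
    simp
  by_cases hxv : x = v
  · subst hxv
    simp
  obtain ⟨a, hxa, hau⟩ := exists_adj_dist_add_one hG.1 hxu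
  obtain ⟨b, hxb, hbv⟩ := exists_adj_dist_add_one hG.1 hxv
  have hxa' := SimpleGraph.dist_eq_one_iff_adj.2 hxa
  have hxb' := SimpleGraph.dist_eq_one_iff_adj.2 hxb
  unfold OnGeodesic at hu hv hmax
  have hgxa := hG.1.dist_triangle (u := g) (v := x) (w := a)
  have hgxb := hG.1.dist_triangle (u := g) (v := x) (w := b)
  have hgav := hG.1.dist_triangle (u := g) (v := a) (w := v)
  have hgbu := hG.1.dist_triangle (u := g) (v := b) (w := u)
  have hav : G.dist x v ≤ G.dist a v := by
    by_contra
    have := hmax a (by omega) (by omega)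
    omega
  have hbu : G.dist x u ≤ G.dist b u := by
    by_contra
    have := hmax b (by omega) (by omega)
    omega
  have hc₁ := SimpleGraph.dist_comm (G := G) (u := x) (v := a)
  have hc₂ := SimpleGraph.dist_comm (G := G) (u := u) (v := x)
  have hc₃ := SimpleGraph.dist_comm (G := G) (u := u) (v := v)
  have hc₄ := SimpleGraph.dist_comm (G := G) (u := v) (v := b)
  have hc₅ := SimpleGraph.dist_comm (G := G) (u := v) (v := x)
  have hab := hG.1.dist_triangle (u := a) (v := x) (w := b)
  have hab0 := hG.1.pos_dist_of_ne (u := a) (v := b) (by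
    rintro rfl
    omega)
  have habv := hG.1.dist_triangle (u := a) (v := b) (w := v)
  by_cases h : G.dist a v = G.dist x v
  · have hab1 : G.dist a b = 1 := by
      by_contra
      rcases hG.onGeodesic_or (a := a) (b := x) (c := b) (by unfold OnGeodesic; omega) v
        with h' | h'
      all_goals
        unfold OnGeodesic at h'
        omega
    rcases hG.onGeodesic_or (a := a) (b := b) (c := v) (by unfold OnGeodesic; omega) u with h' | h'
    all_goals
      unfold OnGeodesic at h'
      omega
  · rcases hG.onGeodesic_or (a := a) (b := x) (c := v) (by unfold OnGeodesic; omega) u with h' | h'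
    all_goals
      unfold OnGeodesic at h'
      omega

lemma bddAbove_level_commonAncestors (u v : V) :
    BddAbove {n | ∃ x, IsAncestor G x u ∧ IsAncestor G x v ∧ level G x = n} :=
  ((Set.finite_range (level G)).subset (by rintro _ ⟨x, -, -, rfl⟩; exact ⟨x, rfl⟩)).bddAbove

lemma level_le_phi {u v x : V} (hu : IsAncestor G x u) (hv : IsAncestor G x v) :
    level G x ≤ phi G u v :=
  le_csSup (bddAbove_level_commonAncestors u v) ⟨x, hu, hv, rfl⟩

lemma exists_level_eq_phi {u v g : V} (hu : IsAncestor G g u) (hv : IsAncestor G g v) :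
    ∃ x, IsAncestor G x u ∧ IsAncestor G x v ∧ level G x = phi G u v :=
  Nat.sSup_mem (s := {n | ∃ x, IsAncestor G x u ∧ IsAncestor G x v ∧ level G x = n})
    ⟨level G g, g, hu, hv, rfl⟩ (bddAbove_level_commonAncestors u v)

lemma IsBlockGraph.dist_formula_of_gate_ne (hG : IsBlockGraph G) {u v g h : V}
    (hg : IsGate G g u) (hh : IsGate G h v) (hgh : g ≠ h) :
    G.dist u v = level G u + level G v + 1 ∧ delta G u v = 1 ∧ phi G u v = 0 ∧
      rho G u v = 0 := by
  have hgh1 := hG.dist_eq_one_of_isCentral hg.1 hh.1 hgh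
  have hgv := hh.2 g hg.1 hgh
  have hhu := hg.2 h hh.1 hgh.symm
  have hLu := hg.level_eq
  have hLv := hh.level_eq
  have hc₁ := SimpleGraph.dist_comm (G := G) (u := u) (v := v)
  have hc₂ := SimpleGraph.dist_comm (G := G) (u := h) (v := v)
  have hc₃ := SimpleGraph.dist_comm (G := G) (u := g) (v := u)
  have hc₄ := SimpleGraph.dist_comm (G := G) (u := h) (v := u)
  have hd : G.dist u v = level G u + level G v + 1 := by
    rcases hG.onGeodesic_or (a := g) (b := h) (c := v) (by unfold OnGeodesic; omega) u with h' | h'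
    all_goals
      unfold OnGeodesic at h'
      omega
  have hgo : OnGeodesic G g u v := by unfold OnGeodesic; omega
  have hho : OnGeodesic G h u v := by unfold OnGeodesic; omega
  refine ⟨hd, if_pos ⟨g, h, hgh, hg.1, hh.1, hgo, hho⟩, ?_, if_pos ⟨g, hgo, .inl hg.1⟩⟩
  obtain ⟨x, hxu, hxv, hx⟩ := exists_level_eq_phi (isAncestor_of_isCentral hg.1 u)
    (isAncestor_of_isCentral hg.1 v)
  rw [← hx]
  rcases hg.onGeodesic_of_isAncestor hG hxu with h₁ | h₁
  · exact level_eq_zero h₁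
  rcases hh.onGeodesic_of_isAncestor hG hxv with h₂ | h₂
  · exact level_eq_zero h₂
  have h₃ := (hg.of_onGeodesic hG h₁).2 h hh.1 hgh.symm
  have h₄ := (hh.of_onGeodesic hG h₂).2 g hg.1 hgh
  omega

lemma IsBlockGraph.dist_formula_of_gate_eq (hG : IsBlockGraph G) {u v g : V}
    (hu : IsGate G g u) (hv : IsGate G g v) :
    delta G u v = 0 ∧ G.dist u v + 2 * phi G u v + rho G u v = level G u + level G v := by
  have hLu := hu.level_eq
  have hLv := hv.level_eq
  have hugv := hG.1.dist_triangle (u := u) (v := g) (w := v)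
  rw [SimpleGraph.dist_comm (u := u) (v := g)] at hugv
  have hcent : ∀ x, IsCentral G x → OnGeodesic G x u v → x = g := by
    intro x hx hxo
    by_contra hxg
    have h₁ := hu.2 x hx hxg
    have h₂ := hv.2 x hx hxg
    rw [OnGeodesic, SimpleGraph.dist_comm (u := u) (v := x)] at hxo
    omega
  have hanc : ∀ y, OnGeodesic G y g u → OnGeodesic G y g v →
      level G y = G.dist g y ∧ G.dist g y ≤ phi G u v := fun y hyu hyv => by
    have := (hu.of_onGeodesic hG hyu).level_eq
    exact ⟨this, this ▸ level_le_phi ⟨g, hu.1, hyu⟩ ⟨g, hu.1, hyv⟩⟩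
  have hanc' : ∀ y, IsAncestor G y u → IsAncestor G y v → IsCentral G y ∨
      (OnGeodesic G y g u ∧ OnGeodesic G y g v) := fun y hyu hyv => by
    rcases hu.onGeodesic_of_isAncestor hG hyu with h | h
    · exact .inl h
    · exact (hv.onGeodesic_of_isAncestor hG hyv).imp id fun h' => ⟨h, h'⟩
  obtain ⟨x, hxu, hxv, hx⟩ : ∃ x, OnGeodesic G x g u ∧ OnGeodesic G x g v ∧
      G.dist g x = phi G u v := by
    obtain ⟨x, hxu, hxv, hx⟩ := exists_level_eq_phi (isAncestor_of_isCentral hu.1 u)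
      (isAncestor_of_isCentral hu.1 v)
    rcases hanc' x hxu hxv with h | ⟨h, h'⟩
    · refine ⟨g, by simp [OnGeodesic], by simp [OnGeodesic], ?_⟩
      rw [← hx, level_eq_zero h, SimpleGraph.dist_self]
    · exact ⟨x, h, h', (hanc x h h').1.symm.trans hx⟩
  have hlower := hG.dist_add_dist_le hxu hxv fun y hyu hyv => hx ▸ (hanc y hyu hyv).2
  have hupper := hG.1.dist_triangle (u := u) (v := x) (w := v)
  have hxu' := hxu
  have hxv' := hxv
  unfold OnGeodesic at hxu' hxv'
  rw [SimpleGraph.dist_comm (u := u) (v := x)] at hlower hupper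
  refine ⟨if_neg ?_, ?_⟩
  · rintro ⟨a, b, hab, ha, hb, hao, hbo⟩
    exact hab ((hcent a ha hao).trans (hcent b hb hbo).symm)
  · unfold rho
    split_ifs with hρ
    · obtain ⟨y, hyo, hy⟩ := hρ
      have hy' : OnGeodesic G y g u ∧ OnGeodesic G y g v := by
        rcases hy with hy | ⟨hyu, hyv⟩
        · rw [hcent y hy hyo]
          simp [OnGeodesic]
        · rcases hanc' y hyu hyv with h | h
          · rw [hcent y h hyo]
            simp [OnGeodesic]
          · exact h
      have := (hanc y hy'.1 hy'.2).2
      obtain ⟨hyu, hyv⟩ := hy'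
      rw [OnGeodesic] at hyu hyv hyo
      rw [SimpleGraph.dist_comm (u := u) (v := y)] at hyo
      omega
    · have hne : ¬ OnGeodesic G x u v := fun h =>
        hρ ⟨x, h, .inr ⟨⟨g, hu.1, hxu⟩, ⟨g, hu.1, hxv⟩⟩⟩
      rw [OnGeodesic, SimpleGraph.dist_comm (u := u) (v := x)] at hne
      omega

end BlockGraph

/-- In a block graph,
`d(u,v) = L(u) + L(v) + δ(u,v) - 2φ(u,v) - ρ(u,v)`. -/
theorem stmt3 {V : Type*} [Fintype V] (G : SimpleGraph V) (hG : IsBlockGraph G) (u v : V) :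
    (G.dist u v : ℤ) = (level G u : ℤ) + (level G v : ℤ) + (delta G u v : ℤ)
      - 2 * (phi G u v : ℤ) - (rho G u v : ℤ) := by
  obtain ⟨g, hg⟩ := hG.exists_gate u
  obtain ⟨h, hh⟩ := hG.exists_gate v
  by_cases hgh : g = h
  · subst hgh
    have := hG.dist_formula_of_gate_eq hg hh
    omega
  · have := hG.dist_formula_of_gate_ne hg hh hgh
    omega

end RadioLabeling
end

section
/- Let T be a tree with exactly two weight centers, |W(T)| = 2. Then its line graph 𝓛(T) has exactly one weight center, |W(𝓛(T))| = 1. -/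
open scoped Classical

namespace RadioLabeling

variable {V : Type*} [Fintype V]

noncomputable instance edgeSetFintype (G : SimpleGraph V) : Fintype G.edgeSet :=
  Set.Finite.fintype (Set.toFinite _)

/-- The set `B(T)` of vertices of the line graph of `T` (i.e. edges of `T`): the vertex `w`
(the unique weight center of the line graph) together with all edges of `T` whose far endpoint
is a descendant, in `T` rooted at its weight center `r`, of the far endpoint of `w`;
equivalently, the edges `e` having an endpoint `x` such that both endpoints of `w` lie on the
`(r,x)`-geodesic in `T`. -/
def edgeDescSet (T : SimpleGraph V) (r : V) (w : T.edgeSet) : Set T.edgeSet :=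
  {e | e = w ∨ ∃ x ∈ (e : Sym2 V), ∀ y ∈ (w : Sym2 V), T.dist r x = T.dist r y + T.dist y x}

open SimpleGraph

/-- In a tree, a vertex has at most one neighbor closer to a given vertex. -/
lemma eq_of_adj_of_dist_eq_add_one {V : Type*} {T : SimpleGraph V} (hT : T.IsTree)
    {z a b c : V} (hab : T.Adj a b) (hcb : T.Adj c b)
    (ha : T.dist z b = T.dist z a + 1) (hc : T.dist z b = T.dist z c + 1) : a = c := by
  obtain ⟨p, hp⟩ := hT.connected.exists_walk_length_eq_dist z a
  obtain ⟨q, hq⟩ := hT.connected.exists_walk_length_eq_dist z c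
  have hp' : (p.concat hab).IsPath :=
    Walk.isPath_of_length_eq_dist _ (by rw [Walk.length_concat, hp, ha])
  have hq' : (q.concat hcb).IsPath :=
    Walk.isPath_of_length_eq_dist _ (by rw [Walk.length_concat, hq, hc])
  have h := (hT.existsUnique_path z b).unique hp' hq'
  simpa using congrArg Walk.penultimate h

/-- In a connected graph, every vertex other than `u` has a neighbor closer to `u`. -/
lemma exists_adj_dist_eq_add_one {V : Type*} {G : SimpleGraph V} (hG : G.Connected)
    {u x : V} (hx : x ≠ u) : ∃ y, G.Adj y x ∧ G.dist u x = G.dist u y + 1 := by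
  obtain ⟨p, hp⟩ := hG.exists_walk_length_eq_dist x u
  cases p with
  | nil => exact absurd rfl hx
  | @cons _ y _ h p =>
    refine ⟨y, h.symm, ?_⟩
    have h1 := dist_le p
    have h2 := hG.dist_triangle (u := u) (v := y) (w := x)
    rw [dist_eq_one_iff_adj.2 h.symm] at h2
    rw [Walk.length_cons] at hp
    rw [dist_comm (u := y)] at h1
    rw [dist_comm (u := x)] at hp
    omega

/-- The weight of a tree is strictly convex along paths. -/
lemma two_mul_wt_lt {V : Type*} [Fintype V] {T : SimpleGraph V} (hT : T.IsTree)
    {a b c : V} (hab : T.Adj a b) (hcb : T.Adj c b) (hac : a ≠ c) :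
    2 * wt T b < wt T a + wt T c := by
  unfold wt
  rw [Finset.mul_sum, ← Finset.sum_add_distrib]
  refine Finset.sum_lt_sum (fun z _ => ?_) ⟨b, Finset.mem_univ _, ?_⟩
  · have h1 := hT.dist_eq_dist_add_one_of_adj z hab
    have h2 := hT.dist_eq_dist_add_one_of_adj z hcb
    have h3 := fun h h' => hac (eq_of_adj_of_dist_eq_add_one (z := z) hT hab hcb h h')
    by_contra hlt
    exact h3 (by omega) (by omega)
  · simp [dist_eq_one_iff_adj.2 hab.symm]

/-- Along a path in a tree, once the weight does not decrease, it strictly increases. -/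
lemma eq_or_wt_lt_of_isPath_cons {V : Type*} [Fintype V] {T : SimpleGraph V} (hT : T.IsTree)
    {u c : V} (p : T.Walk u c) :
    ∀ {a : V} (h : T.Adj a u), (Walk.cons h p).IsPath → wt T a ≤ wt T u →
      u = c ∨ wt T u < wt T c := by
  induction p with
  | nil => exact fun _ _ _ => Or.inl rfl
  | @cons u v c huv p ih =>
    intro a h hp hle
    rw [Walk.cons_isPath_iff] at hp
    have hav : a ≠ v := by
      rintro rfl
      exact hp.2 (by simp)
    have hlt := two_mul_wt_lt hT h huv.symm hav
    rcases ih huv hp.1 (by omega) with rfl | h'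
    · exact Or.inr (by omega)
    · exact Or.inr (by omega)

/-- Distinct weight centers of a tree are adjacent. -/
lemma adj_of_mem_weightCenters {V : Type*} [Fintype V] {T : SimpleGraph V} (hT : T.IsTree)
    {a c : V} (ha : a ∈ weightCenters T) (hc : c ∈ weightCenters T) (hac : a ≠ c) :
    T.Adj a c := by
  obtain ⟨p, hp⟩ := hT.connected.exists_isPath a c
  cases p with
  | nil => exact absurd rfl hac
  | @cons _ u _ h p =>
    rcases eq_or_wt_lt_of_isPath_cons hT p h hp (ha u) with rfl | h'
    · exact h
    · exact absurd (hc u) (by omega)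

/-- Two edges joined by a walk of length `k` are joined by a walk of length at most `k + 1`
in the line graph. -/
lemma exists_lineGraph_walk_length_le {V : Type*} {G : SimpleGraph V} {w z : V} (q : G.Walk w z)
    (f : G.edgeSet) (hf : z ∈ (f : Sym2 V)) :
    ∀ e : G.edgeSet, w ∈ (e : Sym2 V) →
      ∃ r : G.lineGraph.Walk e f, r.length ≤ q.length + 1 := by
  have base : ∀ (e g : G.edgeSet) (v : V), v ∈ (e : Sym2 V) → v ∈ (g : Sym2 V) →
      ∃ r : G.lineGraph.Walk e g, r.length ≤ 1 := by
    intro e g v he hg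
    by_cases h : e = g
    · subst h
      exact ⟨Walk.nil, by simp⟩
    · exact ⟨(lineGraph_adj_iff_exists.2 ⟨h, v, he, hg⟩).toWalk, by simp⟩
  induction q with
  | nil => exact fun e he => base e f _ he hf
  | @cons w y z h q ih =>
    intro e he
    obtain ⟨r, hr⟩ := base e ⟨s(w, y), h⟩ w he (Sym2.mem_mk_left _ _)
    obtain ⟨r', hr'⟩ := ih hf ⟨s(w, y), h⟩ (Sym2.mem_mk_right _ _)
    refine ⟨r.append r', ?_⟩
    rw [Walk.length_append, Walk.length_cons]
    omega

lemma exists_mem_dist_le_length {V : Type*} {G : SimpleGraph V} (hG : G.Connected)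
    {f e : G.edgeSet} (p : G.lineGraph.Walk f e) :
    ∀ x ∈ (f : Sym2 V), ∃ w ∈ (e : Sym2 V), G.dist w x ≤ p.length := by
  induction p with
  | nil => exact fun x hx => ⟨x, hx, by simp⟩
  | @cons f g e h p ih =>
    intro x hx
    obtain ⟨-, z, hzf, hzg⟩ := lineGraph_adj_iff_exists.1 h
    obtain ⟨w, hw, hle⟩ := ih z hzg
    refine ⟨w, hw, ?_⟩
    have h1 : G.dist z x ≤ 1 := by
      by_cases hzx : z = x
      · simp [hzx]
      · have hf : (f : Sym2 V) = s(z, x) := (Sym2.mem_and_mem_iff hzx).1 ⟨hzf, hx⟩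
        have hadj : G.Adj z x := by
          rw [← mem_edgeSet, ← hf]
          exact f.2
        exact (dist_eq_one_iff_adj.2 hadj).le
    have h2 := hG.dist_triangle (u := w) (v := z) (w := x)
    rw [Walk.length_cons]
    omega

/-- The distance in the line graph of a tree from an edge `uv` to an edge `yx` whose endpoint
`x` is the one further from `u`. -/
lemma dist_lineGraph_eq_min {V : Type*} {T : SimpleGraph V} (hT : T.IsTree) {u v x y : V}
    (huv : T.Adj u v) (hyx : T.Adj y x) (hd : T.dist u x = T.dist u y + 1) :
    T.lineGraph.dist ⟨s(x, y), hyx.symm⟩ ⟨s(u, v), huv⟩ = min (T.dist u x) (T.dist v x) := by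
  have key : ∀ w ∈ s(u, v), ∃ r : T.lineGraph.Walk ⟨s(x, y), hyx.symm⟩ ⟨s(u, v), huv⟩,
      r.length ≤ T.dist w y + 1 := by
    intro w hw
    obtain ⟨q, hq⟩ := hT.connected.exists_walk_length_eq_dist y w
    obtain ⟨r, hr⟩ := exists_lineGraph_walk_length_le q ⟨s(u, v), huv⟩ hw
      ⟨s(x, y), hyx.symm⟩ (Sym2.mem_mk_right _ _)
    exact ⟨r, by rwa [hq, dist_comm] at hr⟩
  apply le_antisymm
  · rcases hT.dist_eq_dist_add_one_of_adj x huv with h | h <;>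
      rw [dist_comm (v := u), dist_comm (v := v)] at h
    · rw [min_eq_right (by omega)]
      by_cases hxv : x = v
      · subst hxv
        have hy : u = y := by
          rw [dist_self] at h
          exact hT.connected.dist_eq_zero_iff.1 (by omega)
        subst hy
        simp [Sym2.eq_swap]
      · obtain ⟨p, hp, hpd⟩ := exists_adj_dist_eq_add_one hT.connected hxv
        have h1 := hT.connected.dist_triangle (u := u) (v := v) (w := p)
        have h2 := hT.connected.dist_triangle (u := u) (v := p) (w := x)
        rw [dist_eq_one_iff_adj.2 huv] at h1
        rw [dist_eq_one_iff_adj.2 hp] at h2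
        obtain rfl := eq_of_adj_of_dist_eq_add_one hT hyx hp hd (by omega)
        obtain ⟨r, hr⟩ := key v (Sym2.mem_mk_right _ _)
        have := dist_le r
        omega
    · rw [min_eq_left (by omega)]
      obtain ⟨r, hr⟩ := key u (Sym2.mem_mk_left _ _)
      have := dist_le r
      omega
  · obtain ⟨r, -⟩ := key u (Sym2.mem_mk_left _ _)
    obtain ⟨r, hr⟩ := r.reachable.exists_walk_length_eq_dist
    obtain ⟨w, hw, hle⟩ := exists_mem_dist_le_length hT.connected r x (Sym2.mem_mk_left _ _)
    rw [← hr]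
    rcases Sym2.mem_iff.1 hw with rfl | rfl
    · exact (min_le_left _ _).trans hle
    · exact (min_le_right _ _).trans hle

/-- The weight of the line graph of a tree at an edge, in terms of the weights of the tree at
its endpoints. -/
lemma two_mul_wt_lineGraph_add_card {V : Type*} [Fintype V] {T : SimpleGraph V} (hT : T.IsTree)
    {u v : V} (huv : T.Adj u v) :
    2 * wt T.lineGraph ⟨s(u, v), huv⟩ + Fintype.card V = wt T u + wt T v := by
  choose p hp hpd using fun (x : V) (hx : x ≠ u) => exists_adj_dist_eq_add_one hT.connected hx
  have hsum : wt T.lineGraph ⟨s(u, v), huv⟩ = ∑ x : V, min (T.dist u x) (T.dist v x) := by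
    rw [← Finset.sum_erase Finset.univ (a := u) (by simp)]
    symm
    refine Finset.sum_bij
      (fun x hx => ⟨s(x, p x (Finset.ne_of_mem_erase hx)), (hp x _).symm⟩)
      (fun _ _ => Finset.mem_univ _) ?_ ?_ ?_
    · intro x hx y hy hxy
      rcases Sym2.eq_iff.1 (congrArg Subtype.val hxy) with h | h
      · exact h.1
      · have h1 := hpd x (Finset.ne_of_mem_erase hx)
        have h2 := hpd y (Finset.ne_of_mem_erase hy)
        rw [h.2] at h1
        rw [← h.1] at h2
        omega
    · have far : ∀ x y : V, T.Adj y x → T.dist u x = T.dist u y + 1 →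
          ∃ (hx : x ≠ u), p x hx = y := by
        intro x y hyx hd
        have hx : x ≠ u := by
          rintro rfl
          simp at hd
        exact ⟨hx, eq_of_adj_of_dist_eq_add_one hT (hp x hx) hyx (hpd x hx) hd⟩
      rintro ⟨e, he⟩ -
      induction e with
      | _ x y =>
        rcases hT.dist_eq_dist_add_one_of_adj u he with h | h
        · obtain ⟨hx, hpx⟩ := far x y he.symm h
          exact ⟨x, by simpa using hx, by simp [hpx]⟩
        · obtain ⟨hy, hpy⟩ := far y x he h
          exact ⟨y, by simpa using hy, by simp [hpy, Sym2.eq_swap]⟩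
    · intro x hx
      exact (dist_lineGraph_eq_min hT huv (hp x _) (hpd x _)).symm
  rw [hsum, wt, wt, Finset.mul_sum, ← Finset.card_univ, Finset.card_eq_sum_ones,
    ← Finset.sum_add_distrib, ← Finset.sum_add_distrib]
  refine Finset.sum_congr rfl fun x _ => ?_
  have h := hT.dist_eq_dist_add_one_of_adj x huv
  rw [dist_comm (u := u), dist_comm (u := v)]
  omega

/-- if a tree has exactly two weight centers, then its line graph has exactly
one weight center. -/
theorem stmt11 {V : Type*} [Fintype V] (T : SimpleGraph V) (hT : T.IsTree)
    (h2 : (weightCenters T).ncard = 2) :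
    (weightCenters (SimpleGraph.lineGraph T)).ncard = 1 := by
  obtain ⟨a, b, hab, hW⟩ := Set.ncard_eq_two.1 h2
  have ha : a ∈ weightCenters T := by simp [hW]
  have hb : b ∈ weightCenters T := by simp [hW]
  have hadj := adj_of_mem_weightCenters hT ha hb hab
  have hab_wt := two_mul_wt_lineGraph_add_card hT hadj
  refine Set.ncard_eq_one.2 ⟨⟨s(a, b), hadj⟩, Set.eq_singleton_iff_unique_mem.2 ⟨?_, ?_⟩⟩
  · rintro ⟨e, he⟩
    induction e with
    | _ x y =>
      have hxy := two_mul_wt_lineGraph_add_card (u := x) (v := y) hT he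
      have h1 := ha x
      have h2 := hb y
      omega
  · rintro ⟨e, he⟩ hmem
    induction e with
    | _ x y =>
      have hxy := two_mul_wt_lineGraph_add_card (u := x) (v := y) hT he
      have hle := hmem ⟨s(a, b), hadj⟩
      have h_ax := ha x
      have h_by := hb y
      have h_bx := hb x
      have hx : x ∈ weightCenters T := fun z => by
        have := ha z
        omega
      have hy : y ∈ weightCenters T := fun z => by
        have := ha z
        omega
      rw [hW] at hx hy
      have hne : x ≠ y := T.ne_of_adj he
      apply Subtype.ext
      rcases hx with rfl | rfl <;> rcases hy with rfl | rfl
      · exact absurd rfl hne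
      · rfl
      · exact Sym2.eq_swap
      · exact absurd rfl hne

end RadioLabeling
end

section
/- Let T be a tree with diameter d(T) ≥ 3 and |W(T)| = |W(𝓛(T))| = 1. If |V(T)| is even, or |V(T)| is odd and |V(B(T))| < (|V(T)|−1)/2, then 𝓛(T) is not a lower bound block graph; that is, rn(𝓛(T)) > (p−1)(d(𝓛(T))+ε(𝓛(T))) − 2L(𝓛(T)) + ε(𝓛(T)), where p = |V(𝓛(T))|. -/
open scoped Classical

namespace RadioLabeling

variable {V : Type*} [Fintype V]

/-- If `D - (h u + h v) / 2` is a lower bound for the gap between any two labels, then summing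
the gaps of consecutive labels bounds the total spread of the labels from below. -/
theorem exists_spread_ge {E : Type*} (f : E → ℕ) (h : E → ℤ) (D : ℤ)
    (hgap : ∀ u v, u ≠ v → f u ≤ f v → 2 * D - h u - h v ≤ 2 * ((f v : ℤ) - f u))
    (S : Finset E) (hS : S.Nonempty) :
    ∃ m ∈ S, ∃ M ∈ S, (∀ x ∈ S, f x ≤ f M) ∧
      2 * D * ((S.card : ℤ) - 1) - 2 * ∑ x ∈ S, h x + h m + h M ≤ 2 * ((f M : ℤ) - f m) := by
  induction S using Finset.induction_on_max_value f with
  | empty => simp at hS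
  | insert a S ha hmax ih =>
    rcases S.eq_empty_or_nonempty with rfl | hne
    · exact ⟨a, by simp, a, by simp, by simp, by simp; linarith⟩
    · obtain ⟨m, hm, M, hM, -, hb⟩ := ih hne
      refine ⟨m, by simp [hm], a, by simp, ?_, ?_⟩
      · simpa using hmax
      · have := hgap M a (by rintro rfl; exact ha hM) (hmax M hM)
        rw [Finset.sum_insert ha, Finset.card_insert_of_notMem ha]
        push_cast
        linarith

section General

variable {E : Type*} [Fintype E]

/-- Every graph on a finite vertex set has a radio labeling attaining the radio number. -/
theorem exists_isRadioLabeling_span_eq_rn (G : SimpleGraph E) :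
    ∃ f : E → ℕ, IsRadioLabeling G f ∧ span f = rn G := by
  have hne : {s | ∃ f : E → ℕ, IsRadioLabeling G f ∧ span f = s}.Nonempty := by
    refine ⟨_, fun u => (diam G + 1) * (Fintype.equivFin E u : ℕ), fun u v huv => ?_, rfl⟩
    have hne : (Fintype.equivFin E u : ℕ) ≠ Fintype.equivFin E v := fun h =>
      huv ((Fintype.equivFin E).injective (Fin.ext h))
    rw [← Nat.mul_sub, ← Nat.mul_sub]
    rcases lt_or_gt_of_ne hne with h | h
    · have := Nat.le_mul_of_pos_right (diam G + 1) (Nat.sub_pos_of_lt h)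
      omega
    · have := Nat.le_mul_of_pos_right (diam G + 1) (Nat.sub_pos_of_lt h)
      omega
  exact Nat.sInf_mem hne

theorem lower_bound_lt_rn_of_potential (G : SimpleGraph E) [Nonempty E] (h : E → ℤ)
    (hpos : ∀ u, 1 ≤ h u) (hdist : ∀ u v, u ≠ v → 2 * (G.dist u v : ℤ) ≤ h u + h v) :
    ((Fintype.card E : ℤ) - 1) * ((diam G : ℤ) + 1) - ∑ u, h u < rn G := by
  obtain ⟨f, hf, hspan⟩ := exists_isRadioLabeling_span_eq_rn G
  obtain ⟨m, -, M, -, -, hb⟩ := exists_spread_ge f h ((diam G : ℤ) + 1) (fun u v huv hle => by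
    have h1 := hf u v huv
    have h2 := hdist u v huv
    have h3 : diam G + 1 ≤ G.dist u v + (f v - f u) := by omega
    zify [hle] at h3
    linarith) Finset.univ Finset.univ_nonempty
  have hle : f M - f m ≤ span f :=
    Finset.le_sup (f := fun p : E × E => f p.1 - f p.2) (Finset.mem_univ (M, m))
  have h1 := hpos m
  have h2 := hpos M
  rw [Finset.card_univ] at hb
  have : (f M : ℤ) - f m ≤ rn G := by omega
  linarith

theorem isCentral_iff_of_weightCenters_eq {G : SimpleGraph E} {w : E}
    (hw : weightCenters G = {w}) (x : E) : IsCentral G x ↔ x = w := by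
  simp [IsCentral, hw, eq_comm]

theorem level_eq_of_weightCenters_eq {G : SimpleGraph E} {w : E}
    (hw : weightCenters G = {w}) (x : E) : level G x = G.dist x w := by
  simp [level, isCentral_iff_of_weightCenters_eq hw]

theorem eps_eq_one_of_weightCenters_eq {G : SimpleGraph E} {w : E}
    (hw : weightCenters G = {w}) : eps G = 1 := by
  simp [eps, hw]

/-- If more than half of the vertices lie in a set in which no geodesic passes through the
unique weight center `w`, then the lower bound for the radio number is not attained. -/
theorem lower_bound_lt_rn_of_large_side {G : SimpleGraph E} (hG : G.Connected) {w : E}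
    (hw : weightCenters G = {w}) (P : Set E) (hwP : w ∉ P)
    (hP : ∀ e ∈ P, ∀ f ∈ P, G.dist e f + 1 ≤ G.dist e w + G.dist f w)
    (hcard : Fintype.card E + 1 ≤ 2 * P.ncard) :
    ((Fintype.card E : ℤ) - 1) * ((diam G : ℤ) + (eps G : ℤ)) - 2 * (totalLevel G : ℤ)
      + (eps G : ℤ) < (rn G : ℤ) := by
  have : Nonempty E := ⟨w⟩
  have key := lower_bound_lt_rn_of_potential G
    (fun e => 2 * (G.dist e w : ℤ) + 1 - if e ∈ P then 2 else 0) (fun e => by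
      split_ifs with he
      · have := hG.pos_dist_of_ne (u := e) (v := w) (by rintro rfl; exact hwP he)
        omega
      · omega) (fun e f _ => by
      have htri := hG.dist_triangle (u := e) (v := w) (w := f)
      rw [G.dist_comm (u := w)] at htri
      split_ifs with he hf hf
      · have := hP e he f hf
        omega
      all_goals omega)
  have hsum : ∑ e, (2 * (G.dist e w : ℤ) + 1 - if e ∈ P then 2 else 0)
      = 2 * (totalLevel G : ℤ) + Fintype.card E - 2 * P.ncard := by
    rw [Finset.sum_sub_distrib, Finset.sum_add_distrib, ← Finset.mul_sum]
    simp only [Finset.sum_ite, totalLevel, level_eq_of_weightCenters_eq hw]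
    rw [Set.ncard_eq_toFinset_card', ← Set.filter_mem_univ_eq_toFinset]
    simp [mul_comm]
  rw [hsum] at key
  rw [eps_eq_one_of_weightCenters_eq hw]
  push_cast
  linarith

end General

section Connected

variable {E : Type*} {G : SimpleGraph E}

theorem exists_adj_dist_add_one_s13 (hG : G.Connected) {u v : E} (h : v ≠ u) :
    ∃ q, G.Adj v q ∧ G.dist u q + 1 = G.dist u v := by
  obtain ⟨p, hp⟩ := hG.exists_walk_length_eq_dist v u
  cases p with
  | nil => exact absurd rfl h
  | @cons _ q _ hadj p =>
    refine ⟨q, hadj, ?_⟩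
    have h1 := G.dist_le p
    have h2 := hG.dist_triangle (u := v) (v := q) (w := u)
    rw [SimpleGraph.dist_eq_one_iff_adj.2 hadj] at h2
    rw [SimpleGraph.Walk.length_cons] at hp
    rw [G.dist_comm (u := u), G.dist_comm (u := u)]
    omega

/-- A set that can only be left through `w` contains, for each of its vertices `x`, the
last vertex before `w` on some geodesic from `x` to `w`. -/
theorem exists_mem_adj_dist_add_one_le (hG : G.Connected) {w : E} {P : Set E} (hwP : w ∉ P)
    (hclosed : ∀ e ∈ P, ∀ f, G.Adj e f → f ∉ P → f = w) {x : E} (hx : x ∈ P) :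
    ∃ y ∈ P, G.Adj y w ∧ G.dist x y + 1 ≤ G.dist x w := by
  induction hn : G.dist x w generalizing x with
  | zero =>
    rw [hG.dist_eq_zero_iff] at hn
    exact absurd (hn ▸ hx) hwP
  | succ n ih =>
    obtain ⟨q, hq, hqd⟩ := exists_adj_dist_add_one_s13 hG (u := w) (v := x)
      (by rintro rfl; exact hwP hx)
    by_cases hqP : q ∈ P
    · obtain ⟨y, hy, hyw, hyd⟩ := ih hqP (by rw [G.dist_comm] at hqd hn; omega)
      refine ⟨y, hy, hyw, ?_⟩
      have := hG.dist_triangle (u := x) (v := q) (w := y)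
      rw [SimpleGraph.dist_eq_one_iff_adj.2 hq] at this
      omega
    · obtain rfl := hclosed x hx q hq hqP
      exact ⟨x, hx, hq, by simp⟩

theorem lineGraph_connected (hG : G.Connected) [Nonempty G.edgeSet] :
    G.lineGraph.Connected := by
  have key : ∀ (x y : E) (_ : G.Walk x y) (e f : G.edgeSet), x ∈ (e : Sym2 E) →
      y ∈ (f : Sym2 E) → G.lineGraph.Reachable e f := by
    have hshare : ∀ (x : E) (e f : G.edgeSet), x ∈ (e : Sym2 E) → x ∈ (f : Sym2 E) →
        G.lineGraph.Reachable e f := by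
      intro x e f he hf
      by_cases hef : e = f
      · rw [hef]
      · exact (SimpleGraph.lineGraph_adj_iff_exists.2 ⟨hef, x, he, hf⟩).reachable
    intro x y p
    induction p with
    | nil => exact fun e f he hf => hshare _ e f he hf
    | @cons u v _ hadj p ih =>
      exact fun e f he hf => (hshare u e ⟨s(u, v), hadj⟩ he (by simp)).trans
        (ih ⟨s(u, v), hadj⟩ f (by simp) hf)
  refine (SimpleGraph.connected_iff _).2 ⟨fun e f => ?_, inferInstance⟩
  obtain ⟨p⟩ := hG.preconnected (e : Sym2 E).out.1 (f : Sym2 E).out.1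
  exact key _ _ p e f (Sym2.out_fst_mem _) (Sym2.out_fst_mem _)

/-- A set of edges that can only be left through `w`, and meets `w` in a single vertex `v`,
has no geodesic of the line graph through `w`. -/
theorem lineGraph_dist_add_one_le (hG : G.lineGraph.Connected) {w : G.edgeSet}
    {P : Set G.edgeSet} (hwP : w ∉ P) (v : E)
    (hv : ∀ e ∈ P, G.lineGraph.Adj e w → v ∈ (e : Sym2 E))
    (hclosed : ∀ e ∈ P, ∀ f, G.lineGraph.Adj e f → f ∉ P → f = w) {e f : G.edgeSet}
    (he : e ∈ P) (hf : f ∈ P) :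
    G.lineGraph.dist e f + 1 ≤ G.lineGraph.dist e w + G.lineGraph.dist f w := by
  obtain ⟨e', he', hew, hed⟩ := exists_mem_adj_dist_add_one_le hG hwP hclosed he
  obtain ⟨f', hf', hfw, hfd⟩ := exists_mem_adj_dist_add_one_le hG hwP hclosed hf
  have hef : G.lineGraph.dist e' f' ≤ 1 := by
    by_cases h : e' = f'
    · simp [h]
    · exact (SimpleGraph.dist_eq_one_iff_adj.2 (SimpleGraph.lineGraph_adj_iff_exists.2
        ⟨h, v, hv e' he' hew, hv f' hf' hfw⟩)).le
  have h1 := hG.dist_triangle (u := e) (v := e') (w := f)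
  have h2 := hG.dist_triangle (u := e') (v := f') (w := f)
  rw [G.lineGraph.dist_comm (u := f') (v := f)] at h2
  omega

/-- In a tree rooted at `r` with parent map `par`, the proper descendants of `b` are the
vertices whose parent is a descendant of `b`. -/
theorem parent_descendant_iff {T : SimpleGraph E} (hT : T.IsTree) {r : E} {par : E → E}
    {far : T.edgeSet → E}
    (hpar : ∀ c, c ≠ r → T.Adj c (par c) ∧ T.dist r (par c) + 1 = T.dist r c)
    (hfar : ∀ e, far e ≠ r ∧ (e : Sym2 E) = s(far e, par (far e)))
    {b c : E} (hc : c ≠ r) (hcb : c ≠ b) :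
    T.dist r (par c) = T.dist r b + T.dist b (par c) ↔
      T.dist r c = T.dist r b + T.dist b c := by
  have hconn := hT.connected
  obtain ⟨hadj, hd⟩ := hpar c hc
  have htri := hconn.dist_triangle (u := r) (v := b) (w := c)
  constructor
  · intro h
    have h1 := hconn.dist_triangle (u := b) (v := par c) (w := c)
    rw [SimpleGraph.dist_eq_one_iff_adj.2 hadj.symm] at h1
    omega
  · intro h
    obtain ⟨q, hq, hqd⟩ := exists_adj_dist_add_one_s13 hconn hcb
    have h1 := hconn.dist_triangle (u := r) (v := b) (w := q)
    have h2 := hconn.dist_triangle (u := r) (v := q) (w := c)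
    rw [SimpleGraph.dist_eq_one_iff_adj.2 hq.symm] at h2
    obtain ⟨hz, he⟩ := hfar ⟨s(c, q), hq⟩
    have hqp : q = par c := by
      rcases Sym2.eq_iff.1 he with ⟨h3, h4⟩ | ⟨h3, h4⟩
      · rw [h4, ← h3]
      · have h5 := (hpar _ hz).2
        rw [← h3, ← h4] at h5
        omega
    rw [← hqp]
    omega

end Connected

/-- In a tree rooted at `r`, the edges are exactly the pairs consisting of a vertex other than
`r` and its parent; `far e` is the endpoint of `e` farther from `r`. -/
theorem exists_parent {T : SimpleGraph V} (hT : T.IsTree) (r : V) :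
    ∃ (par : V → V) (far : T.edgeSet → V),
      (∀ c, c ≠ r → T.Adj c (par c) ∧ T.dist r (par c) + 1 = T.dist r c) ∧
      (∀ e, far e ≠ r ∧ (e : Sym2 V) = s(far e, par (far e))) ∧
      ∀ c, c ≠ r → ∃ e, far e = c := by
  have hex : ∀ c, ∃ q, c ≠ r → T.Adj c q ∧ T.dist r q + 1 = T.dist r c := fun c => by
    by_cases hc : c = r
    · exact ⟨c, fun h => absurd hc h⟩
    · obtain ⟨q, hq⟩ := exists_adj_dist_add_one_s13 hT.connected hc
      exact ⟨q, fun _ => hq⟩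
  choose par hpar using hex
  let up : {c // c ≠ r} → T.edgeSet := fun c => ⟨s(c.1, par c.1), (hpar c.1 c.2).1⟩
  have hinj : Function.Injective up := by
    rintro ⟨c, hc⟩ ⟨c', hc'⟩ h
    have h' : s(c, par c) = s(c', par c') := congrArg Subtype.val h
    rcases Sym2.eq_iff.1 h' with ⟨h1, -⟩ | ⟨h1, h2⟩
    · exact Subtype.ext h1
    · have h3 := (hpar c hc).2
      have h4 := (hpar c' hc').2
      rw [h2] at h3
      rw [← h1] at h4
      omega
  have hcard : Fintype.card {c // c ≠ r} = Fintype.card T.edgeSet := by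
    have h1 := hT.card_edgeFinset
    rw [SimpleGraph.edgeFinset_card] at h1
    have h2 : Fintype.card {c // c ≠ r} = Fintype.card V - 1 := by simp
    omega
  have hbij : Function.Bijective up := (Fintype.bijective_iff_injective_and_card up).2 ⟨hinj, hcard⟩
  choose far hfar using hbij.2
  refine ⟨par, fun e => (far e).1, hpar, fun e => ⟨(far e).2, ?_⟩, fun c hc => ⟨up ⟨c, hc⟩, ?_⟩⟩
  · exact (congrArg Subtype.val (hfar e)).symm
  · exact congrArg Subtype.val (hinj (hfar (up ⟨c, hc⟩)))

/-- If half of the vertices are separated from `r` by `b`, then `b` weighs at most as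
much as `r`. -/
theorem wt_le_of_card_descendants {T : SimpleGraph V} (hT : T.Connected) {r b : V}
    (hcard : Fintype.card V = 2 * {z | T.dist r z = T.dist r b + T.dist b z}.ncard) :
    wt T b ≤ wt T r := by
  set D : Set V := {z | T.dist r z = T.dist r b + T.dist b z} with hD
  have key : ∑ z, ((T.dist z b : ℤ) + T.dist r b * (if z ∈ D then 2 else 0))
      ≤ ∑ z, ((T.dist z r : ℤ) + T.dist r b) := by
    refine Finset.sum_le_sum fun z _ => ?_
    rw [T.dist_comm (u := z) (v := b), T.dist_comm (u := z) (v := r)]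
    split_ifs with hz
    · have hz' : T.dist r z = T.dist r b + T.dist b z := hz
      rw [hz']
      push_cast
      linarith
    · have := hT.dist_triangle (u := b) (v := r) (w := z)
      rw [T.dist_comm (u := b) (v := r)] at this
      omega
  have hDcard : ∑ z, (if z ∈ D then (2 : ℤ) else 0) = Fintype.card V := by
    rw [hcard, Set.ncard_eq_toFinset_card', ← Set.filter_mem_univ_eq_toFinset]
    rw [← Finset.sum_filter, Finset.sum_const]
    simp [mul_comm]
  rw [Finset.sum_add_distrib, Finset.sum_add_distrib, ← Finset.mul_sum, hDcard] at key
  simp only [Finset.sum_const, Finset.card_univ, nsmul_eq_mul] at key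
  zify [wt]
  linarith

/-- for a tree `T` with diameter at least 3 and `|W(T)| = |W(𝓛(T))| = 1`,
if `|V(T)|` is even, or `|V(T)|` is odd and `|B(T)| < (|V(T)|-1)/2`, then `𝓛(T)` is not a
lower bound block graph: `rn(𝓛(T)) > (p-1)(d(𝓛(T))+ε(𝓛(T))) - 2L(𝓛(T)) + ε(𝓛(T))`. -/
theorem stmt13 {V : Type*} [Fintype V] (T : SimpleGraph V) (hT : T.IsTree)
    (hd : 3 ≤ diam T) (r : V) (w : T.edgeSet)
    (hrT : weightCenters T = {r})
    (hwL : weightCenters (SimpleGraph.lineGraph T) = {w})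
    (hcase : Even (Fintype.card V) ∨
      (Odd (Fintype.card V) ∧ (edgeDescSet T r w).ncard < (Fintype.card V - 1) / 2)) :
    ((Fintype.card T.edgeSet : ℤ) - 1) *
          ((diam (SimpleGraph.lineGraph T) : ℤ) + (eps (SimpleGraph.lineGraph T) : ℤ))
        - 2 * (totalLevel (SimpleGraph.lineGraph T) : ℤ) + (eps (SimpleGraph.lineGraph T) : ℤ)
      < (rn (SimpleGraph.lineGraph T) : ℤ) := by
  obtain ⟨par, far, hpar, hfar, hsurj⟩ := exists_parent hT r
  have hconn := hT.connected
  have : Nonempty T.edgeSet := ⟨w⟩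
  have hL := lineGraph_connected hconn
  have hfar_inj : Function.Injective far := fun e f h =>
    Subtype.ext (by rw [(hfar e).2, (hfar f).2, h])
  set b := far w with hb
  have hbr : b ≠ r := (hfar w).1
  have hw : (w : Sym2 V) = s(b, par b) := (hfar w).2
  obtain ⟨habj, hab⟩ := hpar b hbr
  set D : Set V := {z | T.dist r z = T.dist r b + T.dist b z} with hD
  have hbD : b ∈ D := by simp [hD]
  have hrD : r ∉ D := fun h => by
    have h1 : T.dist r r = T.dist r b + T.dist b r := h
    have := hconn.pos_dist_of_ne hbr
    simp only [SimpleGraph.dist_self] at h1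
    omega
  have haD : par b ∉ D := fun h => by
    have : T.dist r (par b) = T.dist r b + T.dist b (par b) := h
    omega
  have hstep : ∀ c, c ≠ r → c ≠ b → (par c ∈ D ↔ c ∈ D) := fun c hc hcb =>
    parent_descendant_iff hT hpar hfar hc hcb
  have hS : edgeDescSet T r w = far ⁻¹' D := by
    ext e
    simp only [edgeDescSet, Set.mem_ofPred_eq, Set.mem_preimage]
    constructor
    · rintro (rfl | ⟨x, hx, hxw⟩)
      · exact hbD
      · have hxD : x ∈ D := hxw b (by simp [hw])
        rw [(hfar e).2, Sym2.mem_iff] at hx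
        rcases hx with rfl | rfl
        · exact hxD
        · by_cases heb : far e = b
          · rw [heb]; exact hbD
          · exact (hstep _ (hfar e).1 heb).1 hxD
    · intro he
      refine Or.inr ⟨far e, by rw [(hfar e).2]; simp, fun y hy => ?_⟩
      have he' : T.dist r (far e) = T.dist r b + T.dist b (far e) := he
      rw [hw, Sym2.mem_iff] at hy
      rcases hy with rfl | rfl
      · exact he'
      · have h1 := hconn.dist_triangle (u := r) (v := par b) (w := far e)
        have h2 := hconn.dist_triangle (u := par b) (v := b) (w := far e)
        rw [SimpleGraph.dist_eq_one_iff_adj.2 habj.symm] at h2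
        omega
  have hScard : (edgeDescSet T r w).ncard = D.ncard := by
    rw [hS]
    refine Set.ncard_preimage_of_injective_subset_range hfar_inj fun c hc => ?_
    obtain ⟨e, he⟩ := hsurj c (by rintro rfl; exact hrD hc)
    exact ⟨e, he⟩
  have hE : Fintype.card T.edgeSet + 1 = Fintype.card V := by
    have := hT.card_edgeFinset
    rwa [SimpleGraph.edgeFinset_card] at this
  have hwS : w ∈ far ⁻¹' D := hbD
  have hclosed : ∀ e f, T.lineGraph.Adj e f → far e ∈ D → far f ∉ D → e = w := by
    intro e f hef he hf
    by_contra hne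
    have heb : far e ≠ b := fun h => hne (hfar_inj h)
    have hfb : far f ≠ b := by rintro h; exact hf (h ▸ hbD)
    have hpe := (hstep _ (hfar e).1 heb).2 he
    have hpf : par (far f) ∉ D := fun h => hf ((hstep _ (hfar f).1 hfb).1 h)
    obtain ⟨-, x, hxe, hxf⟩ := SimpleGraph.lineGraph_adj_iff_exists.1 hef
    rw [(hfar e).2, Sym2.mem_iff] at hxe
    rw [(hfar f).2, Sym2.mem_iff] at hxf
    have hxD : x ∈ D := by rcases hxe with rfl | rfl <;> assumption
    rcases hxf with rfl | rfl <;> contradiction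
  have hne : Fintype.card V ≠ 2 * D.ncard := by
    intro h
    have h1 := wt_le_of_card_descendants hconn h
    have hr : r ∈ weightCenters T := by simp [hrT]
    have h2 : b ∈ weightCenters T := fun u => h1.trans (hr u)
    rw [hrT] at h2
    exact hbr h2
  have hside : Fintype.card V + 2 ≤ 2 * D.ncard ∨ 2 * D.ncard + 2 ≤ Fintype.card V := by
    rcases hcase with ⟨k, hk⟩ | ⟨⟨k, hk⟩, hlt⟩ <;> omega
  have hmem : ∀ e, T.lineGraph.Adj e w →
      (far e ∈ D → b ∈ (e : Sym2 V)) ∧ (far e ∉ D → par b ∈ (e : Sym2 V)) := by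
    intro e hew
    have heb : far e ≠ b := fun h => hew.ne (hfar_inj h)
    have hiff := hstep _ (hfar e).1 heb
    obtain ⟨-, x, hxe, hxw⟩ := SimpleGraph.lineGraph_adj_iff_exists.1 hew
    have hxe' := hxe
    rw [(hfar e).2, Sym2.mem_iff] at hxe'
    rw [hw, Sym2.mem_iff] at hxw
    have hxD : x ∈ D ↔ far e ∈ D := by
      rcases hxe' with rfl | rfl
      · rfl
      · exact hiff
    rcases hxw with rfl | rfl
    · exact ⟨fun _ => hxe, fun h => absurd (hxD.1 hbD) h⟩
    · exact ⟨fun h => absurd (hxD.2 h) haD, fun _ => hxe⟩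
  rcases hside with hlarge | hsmall
  · have hwP : w ∉ far ⁻¹' D \ {w} := fun h => h.2 rfl
    refine lower_bound_lt_rn_of_large_side hL hwL _ hwP (fun e he f hf =>
      lineGraph_dist_add_one_le hL hwP b (fun e he hew => (hmem e hew).1 he.1)
        (fun e he f hef hf => ?_) he hf) ?_
    · by_contra hfw
      exact he.2 (hclosed e f hef he.1 fun h => hf ⟨h, hfw⟩)
    · have := Set.ncard_sdiff_singleton_of_mem hwS
      rw [← hS, hScard] at this
      rw [← hS]
      omega
  · have hwP : w ∉ (far ⁻¹' D)ᶜ := fun h => h hwS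
    refine lower_bound_lt_rn_of_large_side hL hwL _ hwP (fun e he f hf =>
      lineGraph_dist_add_one_le hL hwP (par b) (fun e he hew => (hmem e hew).2 he)
        (fun e he f hef hf => hclosed f e hef.symm (not_not.1 hf) he) he hf) ?_
    have := Set.ncard_add_ncard_compl (far ⁻¹' D)
    rw [← hS, hScard, Nat.card_eq_fintype_card] at this
    rw [← hS]
    omega

end RadioLabeling
end
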